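/- For every squarefree integer h ≥ 1 and every real σ > 1/2, one has ∫_0^∞ T(e^u; h) e^{−2σu} du = (φ(h)/(2π h²)) ∫_ℝ f(h; σ + iτ) ∏_{p ∤ h} (1 − 1/p)(1 + f(p; σ + iτ)/p) dτ/(σ² + τ²). -/

import Mathlib

open Finset MeasureTheory Filter

/-- `M(n, z) := ∑_{d ∣ n, d ≤ z} μ(d)`. -/
noncomputable def mobM (n : ℕ) (z : ℝ) : ℤ :=
  ∑ d ∈ n.divisors.filter (fun d : ℕ => (d : ℝ) ≤ z), ArithmeticFunction.moebius d

/-- `S(x, z) := ∑_{n ≤ x} M(n, z)²`. -/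
noncomputable def Ssum (x z : ℝ) : ℝ :=
  ∑ n ∈ Finset.Icc 1 ⌊x⌋₊, ((mobM n z : ℝ)) ^ 2

/-- `S(z) := ∑_{m, n ≤ z} μ(m) μ(n) / [m, n]`. -/
noncomputable def Sz (z : ℝ) : ℝ :=
  ∑ m ∈ Finset.Icc 1 ⌊z⌋₊, ∑ n ∈ Finset.Icc 1 ⌊z⌋₊,
    ((ArithmeticFunction.moebius m : ℝ) * (ArithmeticFunction.moebius n : ℝ)) / (Nat.lcm m n : ℝ)

/-- `f(n; iτ) := ∏_{p ∣ n} |1 - p^{-iτ}|²`. -/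
noncomputable def fI (n : ℕ) (τ : ℝ) : ℝ :=
  ∏ p ∈ n.primeFactors, ‖(1 : ℂ) - (p : ℂ) ^ (-(τ * Complex.I))‖ ^ 2

/-- `f(n; s) := ∏_{p ∣ n} |1 - p^{-s}|²` for complex `s`. -/
noncomputable def fC (n : ℕ) (s : ℂ) : ℝ :=
  ∏ p ∈ n.primeFactors, ‖(1 : ℂ) - (p : ℂ) ^ (-s)‖ ^ 2

/-- The constant `L`. -/
noncomputable def Lconst : ℝ :=
  (1 / (2 * Real.pi)) *
    ∫ τ : ℝ,
      (∏' p : Nat.Primes,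
        (1 - 1 / ((p : ℕ) : ℝ)) * (1 + (fI (p : ℕ) τ - 1) / ((p : ℕ) : ℝ))) / τ ^ 2

/-- `𝓛(y) := exp{(log y)^{3/5} / (log log y)^{1/5}}`. -/
noncomputable def curlyL (y : ℝ) : ℝ :=
  Real.exp ((Real.log y) ^ ((3 : ℝ) / 5) / (Real.log (Real.log y)) ^ ((1 : ℝ) / 5))

/-- `ψ(n) := ∏_{p ∣ n} (p + 1)`. -/
def psi (n : ℕ) : ℕ := ∏ p ∈ n.primeFactors, (p + 1)

/-- `ψ_m(n) := ∏_{p ∣ n, p ∤ m} (p + 1)`. -/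
def psiM (m n : ℕ) : ℕ := ∏ p ∈ n.primeFactors.filter (fun p : ℕ => ¬ p ∣ m), (p + 1)

/-- `r(n) := ∏_{p ∣ n} (1 + 2/√p)`. -/
noncomputable def rfun (n : ℕ) : ℝ := ∏ p ∈ n.primeFactors, (1 + 2 / Real.sqrt p)

/-- `k(n)`, the squarefree kernel of `n`. -/
def ker (n : ℕ) : ℕ := ∏ p ∈ n.primeFactors, p

/-- `T(y; m) := (6/π²) ∑_{d, t ≤ y} μ(d) μ(t) / ψ([d, t, m])`. -/
noncomputable def T (y : ℝ) (m : ℕ) : ℝ :=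
  (6 / Real.pi ^ 2) *
    ∑ d ∈ Finset.Icc 1 ⌊y⌋₊, ∑ t ∈ Finset.Icc 1 ⌊y⌋₊,
      ((ArithmeticFunction.moebius d : ℝ) * (ArithmeticFunction.moebius t : ℝ)) /
        (psi (Nat.lcm (Nat.lcm d t) m) : ℝ)

/-- The constant `L(m)`. -/
noncomputable def Lm (m : ℕ) : ℝ :=
  ((Nat.totient m : ℝ) ^ 2 / (2 * Real.pi * (m : ℝ) ^ 2 * (ker m : ℝ))) *
    ∫ τ : ℝ,
      (fI m τ *
        ∏' p : {p : Nat.Primes // ¬ ((p : ℕ) ∣ m)},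
          (1 - 1 / ((p.1 : ℕ) : ℝ)) ^ 2 * (1 + fI (p.1 : ℕ) τ / ((p.1 : ℕ) : ℝ))) / τ ^ 2

/-- `B := ∏_p (1 - (3p + 1)/(p (p + 1)²))`. -/
noncomputable def Bconst : ℝ :=
  ∏' p : Nat.Primes,
    (1 - (3 * ((p : ℕ) : ℝ) + 1) / (((p : ℕ) : ℝ) * (((p : ℕ) : ℝ) + 1) ^ 2))

/-- `α(n) := ∏_{p ∣ n} (1 - p/(p² + 3p + 1))`. -/
noncomputable def alpha (n : ℕ) : ℝ :=
  ∏ p ∈ n.primeFactors, (1 - (p : ℝ) / ((p : ℝ) ^ 2 + 3 * (p : ℝ) + 1))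

theorem integrable_inv_sq_add_sq {σ : ℝ} (hσ : 0 < σ) :
    Integrable fun τ : ℝ => (σ ^ 2 + τ ^ 2)⁻¹ := by
  have h1 := (integrable_inv_one_add_sq.comp_div hσ.ne').const_mul (σ ^ 2)⁻¹
  refine h1.congr (Eventually.of_forall fun τ => ?_)
  simp only
  field_simp

theorem continuous_exp_neg_mul_abs (c : ℝ) :
    Continuous fun x : ℝ => Complex.exp ((-(c * |x|) : ℝ) : ℂ) := by
  fun_prop

theorem integrable_exp_neg_mul_abs {c : ℝ} (hc : 0 < c) :
    Integrable fun x : ℝ => Complex.exp ((-(c * |x|) : ℝ) : ℂ) := by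
  rw [← integrableOn_univ, ← Set.Iic_union_Ioi (a := (0 : ℝ)), integrableOn_union]
  constructor
  · refine (integrableOn_exp_mul_complex_Iic (a := (c : ℂ)) (by simpa using hc) 0).congr_fun
      (fun x hx => ?_) measurableSet_Iic
    simp [abs_of_nonpos (Set.mem_Iic.1 hx)]
  · refine (integrableOn_exp_mul_complex_Ioi (a := (-c : ℂ)) (by simpa using hc) 0).congr_fun
      (fun x hx => ?_) measurableSet_Ioi
    simp [abs_of_pos (Set.mem_Ioi.1 hx)]

theorem integral_exp_mul_mul_exp_neg_abs {c : ℝ} (hc : 0 < c) (b : ℝ) :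
    ∫ x : ℝ, Complex.exp ((b * x : ℝ) * Complex.I) * Complex.exp ((-(c * |x|) : ℝ) : ℂ) =
      ((2 * c / (c ^ 2 + b ^ 2) : ℝ) : ℂ) := by
  have hint : Integrable fun x : ℝ =>
      Complex.exp ((b * x : ℝ) * Complex.I) * Complex.exp ((-(c * |x|) : ℝ) : ℂ) := by
    refine (integrable_exp_neg_mul_abs hc).bdd_mul (c := 1) ?_ ?_
    · exact (by fun_prop : Continuous _).aestronglyMeasurable
    · exact Eventually.of_forall fun x => by rw [Complex.norm_exp_ofReal_mul_I]
  rw [← intervalIntegral.integral_Iic_add_Ioi (b := 0) hint.integrableOn hint.integrableOn]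
  have h1 : ∫ x in Set.Iic (0 : ℝ),
      Complex.exp ((b * x : ℝ) * Complex.I) * Complex.exp ((-(c * |x|) : ℝ) : ℂ) =
      ∫ x in Set.Iic (0 : ℝ), Complex.exp ((c + b * Complex.I) * x) := by
    refine setIntegral_congr_fun measurableSet_Iic fun x hx => ?_
    simp only [abs_of_nonpos (Set.mem_Iic.1 hx), ← Complex.exp_add]
    push_cast
    ring_nf
  have h2 : ∫ x in Set.Ioi (0 : ℝ),
      Complex.exp ((b * x : ℝ) * Complex.I) * Complex.exp ((-(c * |x|) : ℝ) : ℂ) =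
      ∫ x in Set.Ioi (0 : ℝ), Complex.exp ((-c + b * Complex.I) * x) := by
    refine setIntegral_congr_fun measurableSet_Ioi fun x hx => ?_
    simp only [abs_of_pos (Set.mem_Ioi.1 hx), ← Complex.exp_add]
    push_cast
    ring_nf
  rw [h1, h2, integral_exp_mul_complex_Iic (by simpa using hc),
    integral_exp_mul_complex_Ioi (by simpa using hc)]
  have e1 : (c + b * Complex.I : ℂ) ≠ 0 := fun h => by
    have := congrArg Complex.re h
    simp at this
    exact hc.ne' this
  have e2 : (-c + b * Complex.I : ℂ) ≠ 0 := fun h => by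
    have := congrArg Complex.re h
    simp at this
    exact hc.ne' this
  have e3 : (c ^ 2 + b ^ 2 : ℂ) ≠ 0 := by
    have : (c ^ 2 + b ^ 2 : ℝ) ≠ 0 := by positivity
    exact_mod_cast this
  push_cast
  simp only [mul_zero, Complex.exp_zero]
  field_simp
  ring_nf
  simp only [Complex.I_sq]
  ring

/-- The Fourier transform of the Cauchy density, at an arbitrary real frequency. -/
theorem integral_exp_mul_I_div_sq_add_sq {σ : ℝ} (hσ : 0 < σ) (a : ℝ) :
    ∫ τ : ℝ, Complex.exp ((a * τ : ℝ) * Complex.I) * (((σ ^ 2 + τ ^ 2)⁻¹ : ℝ) : ℂ) =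
      ((Real.pi / σ * Real.exp (-(σ * |a|)) : ℝ) : ℂ) := by
  have hπ := Real.pi_pos
  set g : ℝ → ℂ := fun x => Complex.exp ((-(2 * Real.pi * σ * |x|) : ℝ) : ℂ) with hg
  have hc : 0 < 2 * Real.pi * σ := by positivity
  have hF : FourierTransform.fourier g =
      fun w : ℝ => ((σ / Real.pi * (σ ^ 2 + w ^ 2)⁻¹ : ℝ) : ℂ) := by
    funext w
    rw [Real.fourier_eq']
    have := integral_exp_mul_mul_exp_neg_abs hc (-2 * Real.pi * w)
    simp only [smul_eq_mul, hg]
    have e : ∀ v : ℝ, -2 * Real.pi * inner ℝ v w = -2 * Real.pi * w * v := by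
      intro v; simp; ring
    simp only [e, this]
    congr 1
    field_simp
  have hinv := congrFun (Continuous.fourierInv_fourier_eq (f := g)
    (continuous_exp_neg_mul_abs _) (integrable_exp_neg_mul_abs hc)
    (by rw [hF]; exact ((integrable_inv_sq_add_sq hσ).const_mul _).ofReal)) (a / (2 * Real.pi))
  rw [hF, Real.fourierInv_eq'] at hinv
  have e : ∀ v : ℝ, 2 * Real.pi * inner ℝ v (a / (2 * Real.pi)) = a * v := by
    intro v; simp; field_simp
  simp only [e, smul_eq_mul, hg] at hinv
  have e2 : (2 * Real.pi * σ * |a / (2 * Real.pi)|) = σ * |a| := by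
    rw [abs_div, abs_of_pos (by positivity : 0 < 2 * Real.pi)]
    field_simp
  rw [e2] at hinv
  push_cast at hinv ⊢
  rw [← hinv, ← integral_const_mul]
  congr 1
  funext τ
  have : (σ : ℂ) ≠ 0 := by exact_mod_cast hσ.ne'
  have : (Real.pi : ℂ) ≠ 0 := by exact_mod_cast hπ.ne'
  field_simp
theorem Finset.sum_powerset_sum_powerset_prod_mul_prod_union {ι R : Type*} [DecidableEq ι]
    [CommSemiring R] (S C : Finset ι) (hC : C ⊆ S) (x y w : ι → R) :
    ∑ A ∈ S.powerset, ∑ B ∈ S.powerset,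
      (∏ p ∈ A, x p) * (∏ p ∈ B, y p) * ∏ p ∈ A ∪ B ∪ C, w p =
      ∏ p ∈ S, if p ∈ C then w p * (1 + x p) * (1 + y p)
        else 1 + w p * (x p + y p + x p * y p) := by
  have union_prod : ∀ D : Finset ι, D ⊆ S → ∀ B ∈ S.powerset,
      (∏ p ∈ B, y p) * ∏ p ∈ B ∪ D, w p =
        (∏ p ∈ B, y p * w p) * ∏ p ∈ S \ B, if p ∈ D then w p else 1 := by
    intro D hD B hB
    rw [prod_mul_distrib, mul_assoc, ← prod_filter, ← prod_union]
    · congr 2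
      ext p
      have := @hD p
      simp only [mem_union, mem_filter, mem_sdiff]
      tauto
    · exact disjoint_of_subset_right (filter_subset _ _) disjoint_sdiff
  have inner : ∀ A ∈ S.powerset, ∑ B ∈ S.powerset,
      (∏ p ∈ A, x p) * (∏ p ∈ B, y p) * ∏ p ∈ A ∪ B ∪ C, w p =
      (∏ p ∈ A, x p * (w p * (1 + y p))) *
        ∏ p ∈ S \ A, if p ∈ C then w p * (1 + y p) else 1 + y p * w p := by
    intro A hA
    have hAS := mem_powerset.1 hA
    have hAC : A ∪ C ⊆ S := union_subset hAS hC
    have h1 : ∀ B ∈ S.powerset, (∏ p ∈ A, x p) * (∏ p ∈ B, y p) * ∏ p ∈ A ∪ B ∪ C, w p =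
        (∏ p ∈ A, x p) *
          ((∏ p ∈ B, y p * w p) * ∏ p ∈ S \ B, if p ∈ A ∪ C then w p else 1) := by
      intro B hB
      rw [mul_assoc, ← union_prod _ hAC B hB, union_comm A B, union_assoc]
    rw [sum_congr rfl h1, ← mul_sum, ← prod_add, ← prod_sdiff hAS, mul_comm (∏ p ∈ S \ A, _),
      ← mul_assoc, ← prod_mul_distrib]
    congr 1
    · refine prod_congr rfl fun p hp => ?_
      simp only [mem_union, hp, true_or, if_true]
      ring
    · refine prod_congr rfl fun p hp => ?_
      simp only [mem_union, (mem_sdiff.1 hp).2, false_or]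
      split_ifs <;> ring
  rw [sum_congr rfl inner, ← prod_add]
  refine prod_congr rfl fun p _ => ?_
  split_ifs <;> ring

namespace Nat.Primes

/-- The inclusion of the primes in the natural numbers. -/
def natEmbedding : Nat.Primes ↪ ℕ := ⟨fun p => p, Nat.Primes.coe_nat_injective⟩

theorem natEmbedding_apply (p : Nat.Primes) : natEmbedding p = (p : ℕ) := rfl

/-- The squarefree number whose set of prime factors is `A`. -/
def prodSet (A : Finset Nat.Primes) : ℕ := ∏ p ∈ A, (p : ℕ)

theorem prodSet_eq_prod_map (A : Finset Nat.Primes) :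
    prodSet A = ∏ p ∈ A.map natEmbedding, p := by
  rw [prod_map]; rfl

theorem prime_of_mem_map {A : Finset Nat.Primes} {p : ℕ}
    (hp : p ∈ A.map natEmbedding) : p.Prime := by
  obtain ⟨q, -, rfl⟩ := Finset.mem_map.1 hp
  exact q.2

theorem primeFactors_prodSet (A : Finset Nat.Primes) :
    (prodSet A).primeFactors = A.map natEmbedding := by
  rw [prodSet_eq_prod_map, Nat.primeFactors_prod fun _ => prime_of_mem_map]

theorem prodSet_ne_zero (A : Finset Nat.Primes) : prodSet A ≠ 0 :=
  prod_ne_zero_iff.2 fun p _ => p.2.ne_zero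

theorem prodSet_injective : Function.Injective prodSet := fun A B h => by
  have := congrArg Nat.primeFactors h
  rwa [primeFactors_prodSet, primeFactors_prodSet, Finset.map_inj] at this

theorem mem_range_prodSet {n : ℕ} (hn : Squarefree n) : n ∈ Set.range prodSet := by
  let e : {p // p ∈ n.primeFactors} ↪ Nat.Primes :=
    ⟨fun p => ⟨p.1, Nat.prime_of_mem_primeFactors p.2⟩, fun p q h =>
      Subtype.ext (congrArg (fun r : Nat.Primes => (r : ℕ)) h)⟩
  refine ⟨n.primeFactors.attach.map e, ?_⟩
  rw [prodSet, prod_map]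
  exact (prod_attach n.primeFactors fun p => p).trans (Nat.prod_primeFactors_of_squarefree hn)

theorem coe_dvd_prodSet {A : Finset Nat.Primes} {p : Nat.Primes} :
    (p : ℕ) ∣ prodSet A ↔ p ∈ A := by
  have : (p : ℕ) ∈ (prodSet A).primeFactors ↔ p ∈ A := by
    rw [primeFactors_prodSet, ← natEmbedding_apply, Finset.mem_map' natEmbedding]
  rw [← this, Nat.mem_primeFactors]
  simp [p.2, prodSet_ne_zero]

theorem moebius_prodSet (A : Finset Nat.Primes) :
    ArithmeticFunction.moebius (prodSet A) = ∏ _p ∈ A, (-1) := by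
  rw [prodSet_eq_prod_map, ArithmeticFunction.isMultiplicative_moebius.map_prod_of_prime _
    fun _ => prime_of_mem_map, prod_map]
  exact prod_congr rfl fun p _ => ArithmeticFunction.moebius_apply_prime p.2

theorem cast_prodSet_cpow (A : Finset Nat.Primes) (s : ℂ) :
    (prodSet A : ℂ) ^ s = ∏ p ∈ A, (p : ℂ) ^ s := by
  induction A using Finset.induction_on with
  | empty => simp [prodSet]
  | insert p A hp ih =>
    rw [prod_insert hp, ← ih, prodSet, prod_insert hp, Nat.cast_mul,
      Complex.natCast_mul_natCast_cpow, prodSet]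

theorem prod_primeFactors_prodSet {R : Type*} [CommMonoid R] (A : Finset Nat.Primes) (g : ℕ → R) :
    ∏ p ∈ (prodSet A).primeFactors, g p = ∏ p ∈ A, g p := by
  rw [primeFactors_prodSet, prod_map]
  rfl

theorem lcm_prodSet (A B : Finset Nat.Primes) :
    Nat.lcm (prodSet A) (prodSet B) = prodSet (A ∪ B) := by
  refine Nat.dvd_antisymm (Nat.lcm_dvd ?_ ?_) ?_
  · exact prod_dvd_prod_of_subset _ _ _ subset_union_left
  · exact prod_dvd_prod_of_subset _ _ _ subset_union_right
  · rw [prodSet_eq_prod_map (A ∪ B)]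
    refine Finset.prod_primes_dvd _ (fun p hp => (prime_of_mem_map hp).prime) fun p hp => ?_
    obtain ⟨q, hq, rfl⟩ := Finset.mem_map.1 hp
    rcases mem_union.1 hq with h | h
    · exact (coe_dvd_prodSet.2 h).trans (Nat.dvd_lcm_left _ _)
    · exact (coe_dvd_prodSet.2 h).trans (Nat.dvd_lcm_right _ _)

theorem psi_prodSet (A : Finset Nat.Primes) : psi (prodSet A) = ∏ p ∈ A, ((p : ℕ) + 1) :=
  prod_primeFactors_prodSet A fun p => p + 1

theorem tendsto_powerset_product_atTop :
    Tendsto (fun S : Finset Nat.Primes => S.powerset ×ˢ S.powerset) atTop atTop := by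
  refine tendsto_atTop_finset_of_monotone (fun S S' h => ?_) fun x => ⟨x.1 ∪ x.2, ?_⟩
  · exact product_subset_product (powerset_mono.2 h) (powerset_mono.2 h)
  · exact mem_product.2 ⟨mem_powerset.2 subset_union_left, mem_powerset.2 subset_union_right⟩

end Nat.Primes

theorem le_psi {n m : ℕ} (hn : Squarefree n) (hm : m ≠ 0) (h : n ∣ m) : n ≤ psi m := by
  calc n = ∏ p ∈ n.primeFactors, p := (Nat.prod_primeFactors_of_squarefree hn).symm
    _ ≤ ∏ p ∈ n.primeFactors, (p + 1) := prod_le_prod' fun p _ => Nat.le_succ p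
    _ ≤ psi m := prod_le_prod_of_subset_of_one_le' (Nat.primeFactors_mono h hm)
        fun p _ _ => Nat.le_add_left 1 p

/-- The coefficient of the pair `(d, t)` in the double sum defining `T y h`. -/
noncomputable def pairCoeff (h : ℕ) (x : ℕ × ℕ) : ℝ :=
  ((ArithmeticFunction.moebius x.1 : ℝ) * (ArithmeticFunction.moebius x.2 : ℝ)) /
    (psi (Nat.lcm (Nat.lcm x.1 x.2) h) : ℝ)

theorem pairCoeff_eq_zero {h : ℕ} {x : ℕ × ℕ} (hx : ¬ (Squarefree x.1 ∧ Squarefree x.2)) :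
    pairCoeff h x = 0 := by
  rw [pairCoeff]
  rcases not_and_or.1 hx with hx | hx <;>
    simp [ArithmeticFunction.moebius_eq_zero_of_not_squarefree hx]

theorem abs_pairCoeff_le {h : ℕ} (hh : h ≠ 0) (x : ℕ × ℕ) :
    |pairCoeff h x| ≤ (x.1 : ℝ) ^ (-(1 / 2) : ℝ) * (x.2 : ℝ) ^ (-(1 / 2) : ℝ) := by
  by_cases hx : Squarefree x.1 ∧ Squarefree x.2
  swap
  · rw [pairCoeff_eq_zero hx, abs_zero]
    positivity
  have h1 := hx.1.ne_zero
  have h2 := hx.2.ne_zero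
  have hne : Nat.lcm (Nat.lcm x.1 x.2) h ≠ 0 := Nat.lcm_ne_zero (Nat.lcm_ne_zero h1 h2) hh
  have hd : (x.1 : ℝ) ≤ psi (Nat.lcm (Nat.lcm x.1 x.2) h) := by
    exact_mod_cast le_psi hx.1 hne ((Nat.dvd_lcm_left _ _).trans (Nat.dvd_lcm_left _ _))
  have ht : (x.2 : ℝ) ≤ psi (Nat.lcm (Nat.lcm x.1 x.2) h) := by
    exact_mod_cast le_psi hx.2 hne ((Nat.dvd_lcm_right _ _).trans (Nat.dvd_lcm_left _ _))
  have p1 : (0 : ℝ) < x.1 := by exact_mod_cast Nat.pos_of_ne_zero h1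
  have p2 : (0 : ℝ) < x.2 := by exact_mod_cast Nat.pos_of_ne_zero h2
  have m1 : |(ArithmeticFunction.moebius x.1 : ℝ)| ≤ 1 := by
    exact_mod_cast ArithmeticFunction.abs_moebius_le_one
  have m2 : |(ArithmeticFunction.moebius x.2 : ℝ)| ≤ 1 := by
    exact_mod_cast ArithmeticFunction.abs_moebius_le_one
  rw [pairCoeff, abs_div, abs_mul, Nat.abs_cast, Real.rpow_neg p1.le, Real.rpow_neg p2.le,
    ← mul_inv, ← Real.sqrt_eq_rpow, ← Real.sqrt_eq_rpow, ← Real.sqrt_mul p1.le, ← one_div]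
  refine div_le_div₀ zero_le_one (mul_le_one₀ m1 (abs_nonneg _) m2) (by positivity) ?_
  rw [Real.sqrt_le_left (by positivity)]
  nlinarith

theorem summable_abs_pairCoeff_mul_rpow {h : ℕ} (hh : h ≠ 0) {σ : ℝ} (hσ : 1 / 2 < σ) :
    Summable fun x : ℕ × ℕ => |pairCoeff h x| * ((x.1 : ℝ) ^ (-σ) * (x.2 : ℝ) ^ (-σ)) := by
  have hs : Summable fun n : ℕ => (n : ℝ) ^ (-(1 / 2 + σ)) :=
    Real.summable_nat_rpow.2 (by linarith)
  refine Summable.of_nonneg_of_le (fun x => by positivity) (fun x => ?_)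
    (hs.mul_of_nonneg hs (fun n => by positivity) fun n => by positivity)
  have e : ∀ n : ℕ, (n : ℝ) ^ (-(1 / 2) : ℝ) * (n : ℝ) ^ (-σ) = (n : ℝ) ^ (-(1 / 2 + σ)) := by
    intro n
    rcases Nat.eq_zero_or_pos n with rfl | hn
    · rw [Nat.cast_zero, Real.zero_rpow (by linarith : -(1 / 2 + σ) ≠ 0),
        Real.zero_rpow (by norm_num), zero_mul]
    · rw [← Real.rpow_add (by exact_mod_cast hn)]
      ring_nf
  calc |pairCoeff h x| * ((x.1 : ℝ) ^ (-σ) * (x.2 : ℝ) ^ (-σ))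
      ≤ ((x.1 : ℝ) ^ (-(1 / 2) : ℝ) * (x.2 : ℝ) ^ (-(1 / 2) : ℝ)) *
        ((x.1 : ℝ) ^ (-σ) * (x.2 : ℝ) ^ (-σ)) := by
        gcongr
        exact abs_pairCoeff_le hh x
    _ = (x.1 : ℝ) ^ (-(1 / 2 + σ)) * (x.2 : ℝ) ^ (-(1 / 2 + σ)) := by
        rw [← e, ← e]; ring

theorem hasProd_inv_one_sub_inv_sq :
    HasProd (fun p : Nat.Primes => (1 - 1 / ((p : ℕ) : ℝ) ^ 2)⁻¹) (Real.pi ^ 2 / 6) := by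
  let g : ℕ →*₀ ℝ :=
    { toFun := fun n => 1 / (n : ℝ) ^ 2
      map_zero' := by simp
      map_one' := by simp
      map_mul' := fun m n => by push_cast; ring }
  have hs : Summable fun n => ‖g n‖ := by
    refine hasSum_zeta_two.summable.congr fun n => ?_
    exact (Real.norm_of_nonneg (by positivity : (0 : ℝ) ≤ 1 / (n : ℝ) ^ 2)).symm
  have := EulerProduct.eulerProduct_completely_multiplicative_hasProd hs
  rwa [show ∑' n, g n = Real.pi ^ 2 / 6 from hasSum_zeta_two.tsum_eq] at this

theorem fC_prime (p : Nat.Primes) (s : ℂ) :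
    fC p s = ‖(1 : ℂ) - ((p : ℕ) : ℂ) ^ (-s)‖ ^ 2 := by
  rw [fC, p.2.primeFactors, prod_singleton]

theorem natCast_cpow_neg_conj (n : ℕ) (s : ℂ) :
    (n : ℂ) ^ (-(starRingEnd ℂ) s) = (starRingEnd ℂ) ((n : ℂ) ^ (-s)) := by
  rw [← map_neg, Complex.cpow_conj _ _ (by rw [Complex.natCast_arg]; exact Real.pi_pos.ne),
    Complex.conj_natCast]

theorem ofReal_fC_prime (p : Nat.Primes) (s : ℂ) :
    (fC p s : ℂ) =
      (1 - ((p : ℕ) : ℂ) ^ (-s)) * (1 - ((p : ℕ) : ℂ) ^ (-(starRingEnd ℂ) s)) := by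
  rw [fC_prime, natCast_cpow_neg_conj, ← map_one (starRingEnd ℂ), ← map_sub, map_one,
    Complex.mul_conj, Complex.normSq_eq_norm_sq]

theorem fC_prodSet (A : Finset Nat.Primes) (s : ℂ) :
    fC (Nat.Primes.prodSet A) s = ∏ p ∈ A, fC p s := by
  rw [fC, Nat.Primes.prod_primeFactors_prodSet]
  exact prod_congr rfl fun p _ => (fC_prime p s).symm

theorem abs_fC_prime_sub_one_le (p : Nat.Primes) {s : ℂ} (hs : 0 < s.re) :
    |fC p s - 1| ≤ 3 * ((p : ℕ) : ℝ) ^ (-s.re) := by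
  have hp : (1 : ℝ) < (p : ℕ) := by exact_mod_cast p.2.one_lt
  have hz : ‖((p : ℕ) : ℂ) ^ (-s)‖ = ((p : ℕ) : ℝ) ^ (-s.re) := by
    rw [Complex.norm_natCast_cpow_of_pos p.2.pos, Complex.neg_re]
  have hz1 : ((p : ℕ) : ℝ) ^ (-s.re) ≤ 1 := Real.rpow_le_one_of_one_le_of_nonpos hp.le (by linarith)
  have h0 : 0 ≤ ((p : ℕ) : ℝ) ^ (-s.re) := by positivity
  have h1 : ‖(1 : ℂ) - ((p : ℕ) : ℂ) ^ (-s)‖ ≤ 1 + ((p : ℕ) : ℝ) ^ (-s.re) := by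
    refine (norm_sub_le _ _).trans ?_
    rw [hz, norm_one]
  have h2 : 1 - ((p : ℕ) : ℝ) ^ (-s.re) ≤ ‖(1 : ℂ) - ((p : ℕ) : ℂ) ^ (-s)‖ := by
    have := norm_sub_norm_le (1 : ℂ) (((p : ℕ) : ℂ) ^ (-s))
    rwa [hz, norm_one] at this
  rw [fC_prime, abs_le]
  constructor <;> nlinarith [norm_nonneg ((1 : ℂ) - ((p : ℕ) : ℂ) ^ (-s))]

theorem summable_eulerFactor_sub_one {s : ℂ} (hs : 0 < s.re) :
    Summable fun p : Nat.Primes =>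
      (1 - 1 / ((p : ℕ) : ℝ)) * (1 + fC p s / ((p : ℕ) : ℝ)) - 1 := by
  have h1 : Summable fun p : Nat.Primes => 3 * ((p : ℕ) : ℝ) ^ (-(1 + s.re)) :=
    (Nat.Primes.summable_rpow.2 (by linarith)).mul_left 3
  have h2 : Summable fun p : Nat.Primes => 4 * ((p : ℕ) : ℝ) ^ (-2 : ℝ) :=
    (Nat.Primes.summable_rpow.2 (by norm_num)).mul_left 4
  refine (h1.add h2).of_norm_bounded fun p => ?_
  have hp : (1 : ℝ) < (p : ℕ) := by exact_mod_cast p.2.one_lt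
  have hp0 : (0 : ℝ) < (p : ℕ) := by linarith
  have hf := abs_fC_prime_sub_one_le p hs
  have hz1 : ((p : ℕ) : ℝ) ^ (-s.re) ≤ 1 := Real.rpow_le_one_of_one_le_of_nonpos hp.le (by linarith)
  have hf4 : |fC p s| ≤ 4 := by
    rw [abs_le] at hf ⊢
    constructor <;> linarith
  have e : (1 - 1 / ((p : ℕ) : ℝ)) * (1 + fC p s / ((p : ℕ) : ℝ)) - 1 =
      (fC p s - 1) / (p : ℕ) - fC p s / ((p : ℕ) : ℝ) ^ 2 := by
    field_simp; ring
  rw [e]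
  refine (norm_sub_le _ _).trans (add_le_add ?_ ?_)
  · rw [neg_add, Real.rpow_add hp0, Real.rpow_neg_one, norm_div, Real.norm_eq_abs,
      Real.norm_of_nonneg hp0.le, div_eq_mul_inv]
    calc |fC p s - 1| * ((p : ℕ) : ℝ)⁻¹ ≤ 3 * ((p : ℕ) : ℝ) ^ (-s.re) * ((p : ℕ) : ℝ)⁻¹ := by
          gcongr
      _ = _ := by ring
  · rw [Real.rpow_neg hp0.le, Real.rpow_two, norm_div, Real.norm_eq_abs,
      Real.norm_of_nonneg (by positivity), div_eq_mul_inv]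
    gcongr

theorem prod_prodSet_totient (H : Finset Nat.Primes) :
    ∏ p ∈ H, ((((p : ℕ) : ℝ) - 1) / ((p : ℕ) : ℝ) ^ 2) =
      (Nat.totient (Nat.Primes.prodSet H) : ℝ) / (Nat.Primes.prodSet H : ℝ) ^ 2 := by
  have hne : (Nat.Primes.prodSet H : ℝ) ≠ 0 := by exact_mod_cast Nat.Primes.prodSet_ne_zero H
  have h1 : (Nat.totient (Nat.Primes.prodSet H) : ℝ) = ∏ p ∈ H, (((p : ℕ) : ℝ) - 1) := by
    have h := Nat.totient_mul_prod_primeFactors (Nat.Primes.prodSet H)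
    rw [Nat.Primes.prod_primeFactors_prodSet, Nat.Primes.prod_primeFactors_prodSet, mul_comm] at h
    rw [Nat.eq_of_mul_eq_mul_left (Nat.pos_of_ne_zero (Nat.Primes.prodSet_ne_zero H)) h,
      Nat.cast_prod]
    exact prod_congr rfl fun p _ => Nat.cast_pred p.2.pos
  rw [h1, prod_div_distrib, prod_pow, Nat.Primes.prodSet, Nat.cast_prod]

theorem hasProd_eulerFactor (H : Finset Nat.Primes) {s : ℂ} (hs : 0 < s.re) :
    HasProd (fun p : Nat.Primes => if p ∈ H then fC p s / ((p : ℕ) + 1 : ℝ)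
        else 1 + (fC p s - 1) / ((p : ℕ) + 1 : ℝ))
      (Real.pi ^ 2 / 6 * ((Nat.totient (Nat.Primes.prodSet H) : ℝ) /
        (Nat.Primes.prodSet H : ℝ) ^ 2) * (fC (Nat.Primes.prodSet H) s *
          ∏' p : {p : Nat.Primes // ¬ ((p : ℕ) ∣ Nat.Primes.prodSet H)},
            (1 - 1 / ((p.1 : ℕ) : ℝ)) * (1 + fC (p.1 : ℕ) s / ((p.1 : ℕ) : ℝ)))) := by
  set F : Nat.Primes → ℝ := fun p => (1 - 1 / ((p : ℕ) : ℝ)) * (1 + fC p s / ((p : ℕ) : ℝ)) with hF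
  set V : Set Nat.Primes := {p | ¬ ((p : ℕ) ∣ Nat.Primes.prodSet H)} with hV
  have hmul : Multipliable (F ∘ ((↑) : V → Nat.Primes)) := by
    have h := multipliable_one_add_of_summable
      (((summable_eulerFactor_sub_one hs).comp_injective
        (Subtype.val_injective (p := (· ∈ V)))).norm)
    refine h.congr fun p => ?_
    simp [hF]
  have hprod1 : HasProd (V.mulIndicator F) (∏' p : V, F p) :=
    hasProd_subtype_iff_mulIndicator.1 hmul.hasProd
  have hprod2 : HasProd (fun p : Nat.Primes => if p ∈ H then
      (((p : ℕ) : ℝ) - 1) / ((p : ℕ) : ℝ) ^ 2 * fC p s else 1)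
      ((Nat.totient (Nat.Primes.prodSet H) : ℝ) / (Nat.Primes.prodSet H : ℝ) ^ 2 *
        fC (Nat.Primes.prodSet H) s) := by
    have h := hasProd_prod_of_ne_finset_one (L := SummationFilter.unconditional _) (s := H)
      (f := fun p : Nat.Primes => if p ∈ H then
        (((p : ℕ) : ℝ) - 1) / ((p : ℕ) : ℝ) ^ 2 * fC p s else 1) fun p hp => if_neg hp
    rw [prod_congr rfl fun p hp => if_pos hp, prod_mul_distrib, prod_prodSet_totient,
      ← fC_prodSet] at h
    exact h
  convert! (hasProd_inv_one_sub_inv_sq.mul hprod2).mul hprod1 using 1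
  · funext p
    have hp : (1 : ℝ) < (p : ℕ) := by exact_mod_cast p.2.one_lt
    have hp0 : ((p : ℕ) : ℝ) ≠ 0 := by linarith
    have hp1 : ((p : ℕ) : ℝ) + 1 ≠ 0 := by linarith
    have hp2 : ((p : ℕ) : ℝ) - 1 ≠ 0 := by linarith
    have hp3 : 1 - 1 / ((p : ℕ) : ℝ) ^ 2 ≠ 0 := by
      have : 1 - 1 / ((p : ℕ) : ℝ) ^ 2 = (((p : ℕ) : ℝ) + 1) * (((p : ℕ) : ℝ) - 1) /
          ((p : ℕ) : ℝ) ^ 2 := by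
        field_simp; ring
      rw [this]
      positivity
    by_cases hpH : p ∈ H
    · have : p ∉ V := fun h => h (Nat.Primes.coe_dvd_prodSet.2 hpH)
      simp only [hpH, if_true, Set.mulIndicator_of_notMem this, mul_one]
      rw [inv_mul_eq_div, eq_div_iff hp3]
      field_simp
      ring
    · have : p ∈ V := fun h => hpH (Nat.Primes.coe_dvd_prodSet.1 h)
      simp only [hpH, if_false, Set.mulIndicator_of_mem this, mul_one, hF]
      rw [inv_mul_eq_div, eq_div_iff hp3]
      field_simp
      ring
  · rw [mul_assoc, mul_assoc, mul_assoc]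
    rfl

theorem sum_powerset_pairCoeff_mul_cpow (H S : Finset Nat.Primes) (hHS : H ⊆ S) (s : ℂ) :
    ∑ x ∈ S.powerset ×ˢ S.powerset,
      (pairCoeff (Nat.Primes.prodSet H) (Nat.Primes.prodSet x.1, Nat.Primes.prodSet x.2) : ℂ) *
        ((Nat.Primes.prodSet x.1 : ℂ) ^ (-s) *
          (Nat.Primes.prodSet x.2 : ℂ) ^ (-(starRingEnd ℂ) s)) =
      ((∏ p ∈ S, if p ∈ H then fC p s / ((p : ℕ) + 1 : ℝ)
        else 1 + (fC p s - 1) / ((p : ℕ) + 1 : ℝ) : ℝ) : ℂ) := by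
  rw [sum_product]
  have h := Finset.sum_powerset_sum_powerset_prod_mul_prod_union S H hHS
    (fun p : Nat.Primes => -((p : ℕ) : ℂ) ^ (-s))
    (fun p : Nat.Primes => -((p : ℕ) : ℂ) ^ (-(starRingEnd ℂ) s))
    (fun p : Nat.Primes => (((p : ℕ) : ℂ) + 1)⁻¹)
  have neg_prod : ∀ (A : Finset Nat.Primes) (z : ℂ),
      ∏ p ∈ A, -((p : ℕ) : ℂ) ^ z =
        (ArithmeticFunction.moebius (Nat.Primes.prodSet A) : ℂ) *
          (Nat.Primes.prodSet A : ℂ) ^ z := by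
    intro A z
    rw [Nat.Primes.cast_prodSet_cpow, Nat.Primes.moebius_prodSet, Int.cast_prod,
      ← prod_mul_distrib]
    exact prod_congr rfl fun p _ => by push_cast; ring
  calc _ = _ := sum_congr rfl fun A _ => sum_congr rfl fun B _ => ?_
    _ = _ := h
    _ = _ := ?_
  · rw [neg_prod, neg_prod, pairCoeff, Nat.Primes.lcm_prodSet, Nat.Primes.lcm_prodSet,
      Nat.Primes.psi_prodSet, prod_inv_distrib]
    push_cast
    ring
  · rw [Complex.ofReal_prod]
    refine prod_congr rfl fun p _ => ?_
    split_ifs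
    · push_cast
      rw [ofReal_fC_prime]
      ring
    · push_cast
      rw [ofReal_fC_prime]
      ring

theorem norm_pairCoeff_mul_cpow_le (h : ℕ) (x : ℕ × ℕ) (s : ℂ) :
    ‖(pairCoeff h x : ℂ) * ((x.1 : ℂ) ^ (-s) * (x.2 : ℂ) ^ (-(starRingEnd ℂ) s))‖ ≤
      |pairCoeff h x| * ((x.1 : ℝ) ^ (-s.re) * (x.2 : ℝ) ^ (-s.re)) := by
  by_cases hx : Squarefree x.1 ∧ Squarefree x.2
  · rw [norm_mul, norm_mul, Complex.norm_real, Real.norm_eq_abs,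
      Complex.norm_natCast_cpow_of_pos (Nat.pos_of_ne_zero hx.1.ne_zero),
      Complex.norm_natCast_cpow_of_pos (Nat.pos_of_ne_zero hx.2.ne_zero)]
    simp
  · simp [pairCoeff_eq_zero hx]

theorem hasSum_pairCoeff_mul_cpow (H : Finset Nat.Primes) {s : ℂ} (hs : 1 / 2 < s.re) :
    HasSum (fun x : ℕ × ℕ => (pairCoeff (Nat.Primes.prodSet H) x : ℂ) *
        ((x.1 : ℂ) ^ (-s) * (x.2 : ℂ) ^ (-(starRingEnd ℂ) s)))
      ((Real.pi ^ 2 / 6 * ((Nat.totient (Nat.Primes.prodSet H) : ℝ) /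
        (Nat.Primes.prodSet H : ℝ) ^ 2) * (fC (Nat.Primes.prodSet H) s *
          ∏' p : {p : Nat.Primes // ¬ ((p : ℕ) ∣ Nat.Primes.prodSet H)},
            (1 - 1 / ((p.1 : ℕ) : ℝ)) * (1 + fC (p.1 : ℕ) s / ((p.1 : ℕ) : ℝ))) : ℝ) : ℂ) := by
  set f : ℕ × ℕ → ℂ := fun x => (pairCoeff (Nat.Primes.prodSet H) x : ℂ) *
        ((x.1 : ℂ) ^ (-s) * (x.2 : ℂ) ^ (-(starRingEnd ℂ) s)) with hf
  have hsum : Summable f :=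
    (summable_abs_pairCoeff_mul_rpow (Nat.Primes.prodSet_ne_zero H) hs).of_norm_bounded
      fun x => norm_pairCoeff_mul_cpow_le _ x s
  have hinj : Function.Injective
      (Prod.map Nat.Primes.prodSet Nat.Primes.prodSet) :=
    Nat.Primes.prodSet_injective.prodMap Nat.Primes.prodSet_injective
  have hzero : ∀ x, x ∉ Set.range (Prod.map Nat.Primes.prodSet Nat.Primes.prodSet) → f x = 0 := by
    intro x hx
    rw [hf]
    simp only
    rw [pairCoeff_eq_zero, Complex.ofReal_zero, zero_mul]
    rintro ⟨h1, h2⟩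
    obtain ⟨A, hA⟩ := Nat.Primes.mem_range_prodSet h1
    obtain ⟨B, hB⟩ := Nat.Primes.mem_range_prodSet h2
    exact hx ⟨(A, B), Prod.ext hA hB⟩
  have hcomp := (hinj.hasSum_iff hzero).2 hsum.hasSum
  have hlim := Tendsto.comp (show Tendsto _ atTop _ from hcomp)
    Nat.Primes.tendsto_powerset_product_atTop
  have hE : Tendsto _ atTop _ := hasProd_eulerFactor H (s := s) (by linarith)
  have hE' := (Complex.continuous_ofReal.tendsto _).comp hE
  have heq := tendsto_nhds_unique (hlim.congr' ?_) hE'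
  · rw [← heq]
    exact hsum.hasSum
  · filter_upwards [eventually_ge_atTop H] with S hS
    exact sum_powerset_pairCoeff_mul_cpow H S hS s

theorem natCast_cpow_mul_natCast_cpow_conj {m n : ℕ} (hm : m ≠ 0) (hn : n ≠ 0) (σ τ : ℝ) :
    (m : ℂ) ^ (-((σ : ℂ) + (τ : ℂ) * Complex.I)) *
        (n : ℂ) ^ (-(starRingEnd ℂ) ((σ : ℂ) + (τ : ℂ) * Complex.I)) =
      (Real.exp (-(σ * (Real.log m + Real.log n))) : ℂ) *
        Complex.exp (((Real.log n - Real.log m) * τ : ℝ) * Complex.I) := by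
  rw [Complex.cpow_def_of_ne_zero (by exact_mod_cast hm),
    Complex.cpow_def_of_ne_zero (by exact_mod_cast hn), ← Complex.natCast_log,
    ← Complex.natCast_log, Complex.ofReal_exp, ← Complex.exp_add, ← Complex.exp_add]
  congr 1
  simp only [map_add, map_mul, Complex.conj_ofReal, Complex.conj_I]
  push_cast
  ring

theorem exp_log_add_log_mul_exp_abs_sub {m n : ℕ} (hm : m ≠ 0) (hn : n ≠ 0) (σ : ℝ) :
    Real.exp (-(σ * (Real.log m + Real.log n))) *
        Real.exp (-(σ * |Real.log n - Real.log m|)) =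
      Real.exp (-(2 * σ * Real.log (max m n : ℕ))) := by
  rw [← Real.exp_add]
  congr 1
  have hm' : (0 : ℝ) < m := by exact_mod_cast Nat.pos_of_ne_zero hm
  have hn' : (0 : ℝ) < n := by exact_mod_cast Nat.pos_of_ne_zero hn
  rcases le_total m n with h | h
  · have := Real.log_le_log hm' (Nat.cast_le.2 h)
    rw [max_eq_right h, abs_of_nonneg (by linarith)]
    ring
  · have := Real.log_le_log hn' (Nat.cast_le.2 h)
    rw [max_eq_left h, abs_of_nonpos (by linarith)]
    ring

theorem integral_pairCoeff_mul_cpow (h : ℕ) (x : ℕ × ℕ) {σ : ℝ} (hσ : 0 < σ) :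
    ∫ τ : ℝ, (pairCoeff h x : ℂ) * ((x.1 : ℂ) ^ (-((σ : ℂ) + (τ : ℂ) * Complex.I)) *
        (x.2 : ℂ) ^ (-(starRingEnd ℂ) ((σ : ℂ) + (τ : ℂ) * Complex.I))) *
          (((σ ^ 2 + τ ^ 2)⁻¹ : ℝ) : ℂ) =
      ((Real.pi / σ * (pairCoeff h x *
        Real.exp (-(2 * σ * Real.log (max x.1 x.2 : ℕ)))) : ℝ) : ℂ) := by
  by_cases hx : Squarefree x.1 ∧ Squarefree x.2
  swap
  · simp [pairCoeff_eq_zero hx]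
  rw [← exp_log_add_log_mul_exp_abs_sub hx.1.ne_zero hx.2.ne_zero]
  simp only [natCast_cpow_mul_natCast_cpow_conj hx.1.ne_zero hx.2.ne_zero, mul_assoc,
    integral_const_mul, integral_exp_mul_I_div_sq_add_sq hσ]
  simp only [Complex.ofReal_mul]
  ring

theorem continuous_natCast_cpow_vertical (n : ℕ) (a b : ℝ) (ha : a ≠ 0) :
    Continuous fun τ : ℝ => (n : ℂ) ^ ((a : ℂ) + (b * τ : ℝ) * Complex.I) := by
  refine Continuous.const_cpow (by fun_prop) (Or.inr fun τ h => ha ?_)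
  simpa using congrArg Complex.re h

theorem integrable_pairCoeff_mul_cpow (h : ℕ) (x : ℕ × ℕ) {σ : ℝ} (hσ : 0 < σ) :
    Integrable fun τ : ℝ => (pairCoeff h x : ℂ) *
      ((x.1 : ℂ) ^ (-((σ : ℂ) + (τ : ℂ) * Complex.I)) *
        (x.2 : ℂ) ^ (-(starRingEnd ℂ) ((σ : ℂ) + (τ : ℂ) * Complex.I))) *
          (((σ ^ 2 + τ ^ 2)⁻¹ : ℝ) : ℂ) := by
  refine (integrable_inv_sq_add_sq hσ).ofReal.bdd_mul
    (c := |pairCoeff h x| * ((x.1 : ℝ) ^ (-σ) * (x.2 : ℝ) ^ (-σ))) ?_ ?_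
  · refine Continuous.aestronglyMeasurable (continuous_const.mul (Continuous.mul ?_ ?_))
    · convert! continuous_natCast_cpow_vertical x.1 (-σ) (-1) (neg_ne_zero.2 hσ.ne') using 3
      push_cast; ring
    · convert! continuous_natCast_cpow_vertical x.2 (-σ) 1 (neg_ne_zero.2 hσ.ne') using 3
      simp only [map_add, map_mul, Complex.conj_ofReal, Complex.conj_I]
      push_cast; ring
  · refine Eventually.of_forall fun τ => ?_
    simpa using norm_pairCoeff_mul_cpow_le h x ((σ : ℂ) + (τ : ℂ) * Complex.I)

theorem hasSum_integral_vertical (H : Finset Nat.Primes) {σ : ℝ} (hσ : 1 / 2 < σ) :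
    HasSum (fun x : ℕ × ℕ => Real.pi / σ * (pairCoeff (Nat.Primes.prodSet H) x *
        Real.exp (-(2 * σ * Real.log (max x.1 x.2 : ℕ)))))
      (Real.pi ^ 2 / 6 * ((Nat.totient (Nat.Primes.prodSet H) : ℝ) /
        (Nat.Primes.prodSet H : ℝ) ^ 2) * ∫ τ : ℝ,
          (fC (Nat.Primes.prodSet H) ((σ : ℂ) + (τ : ℂ) * Complex.I) *
          ∏' p : {p : Nat.Primes // ¬ ((p : ℕ) ∣ Nat.Primes.prodSet H)},
            (1 - 1 / ((p.1 : ℕ) : ℝ)) *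
              (1 + fC (p.1 : ℕ) ((σ : ℂ) + (τ : ℂ) * Complex.I) / ((p.1 : ℕ) : ℝ))) /
              (σ ^ 2 + τ ^ 2)) := by
  have hσ0 : 0 < σ := by linarith
  have hH := Nat.Primes.prodSet_ne_zero H
  have key := hasSum_integral_of_summable_integral_norm
    (fun x => integrable_pairCoeff_mul_cpow (Nat.Primes.prodSet H) x hσ0) ?_
  · simp only [integral_pairCoeff_mul_cpow _ _ hσ0, tsum_mul_right] at key
    have hts : ∀ τ : ℝ, _ := fun τ => (hasSum_pairCoeff_mul_cpow H
      (s := (σ : ℂ) + (τ : ℂ) * Complex.I) (by simpa using hσ)).tsum_eq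
    simp only [hts, ← Complex.ofReal_mul, integral_complex_ofReal, Complex.hasSum_ofReal] at key
    convert! key using 1
    rw [← integral_const_mul]
    refine integral_congr_ae (Eventually.of_forall fun τ => ?_)
    simp only [div_eq_mul_inv, mul_assoc]
  · refine Summable.of_nonneg_of_le (fun x => integral_nonneg fun τ => norm_nonneg _) (fun x => ?_)
      ((summable_abs_pairCoeff_mul_rpow hH hσ).mul_right (∫ τ : ℝ, (σ ^ 2 + τ ^ 2)⁻¹))
    rw [← integral_const_mul]
    refine integral_mono (integrable_pairCoeff_mul_cpow _ x hσ0).norm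
      ((integrable_inv_sq_add_sq hσ0).const_mul _) fun τ => ?_
    simp only
    rw [norm_mul, Complex.norm_real, Real.norm_of_nonneg (by positivity)]
    gcongr
    simpa using norm_pairCoeff_mul_cpow_le (Nat.Primes.prodSet H) x ((σ : ℂ) + (τ : ℂ) * Complex.I)

theorem integrableOn_indicator_exp {σ : ℝ} (hσ : 0 < σ) (a c : ℝ) :
    IntegrableOn ((Set.Ici a).indicator fun u => c * Real.exp (-(2 * σ * u))) (Set.Ioi 0) := by
  have h : IntegrableOn (fun u => c * Real.exp (-(2 * σ * u))) (Set.Ioi 0) := by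
    have := (integrableOn_exp_mul_Ioi (a := -(2 * σ)) (by linarith) 0).const_mul c
    simp only [neg_mul] at this
    exact this
  exact h.indicator measurableSet_Ici

theorem integral_indicator_exp {σ a : ℝ} (hσ : 0 < σ) (ha : 0 ≤ a) (c : ℝ) :
    ∫ u in Set.Ioi (0 : ℝ), (Set.Ici a).indicator (fun u => c * Real.exp (-(2 * σ * u))) u =
      (2 * σ)⁻¹ * (c * Real.exp (-(2 * σ * a))) := by
  have hset : ∫ u in Set.Ici (0 : ℝ),
      (Set.Ici a).indicator (fun u => c * Real.exp (-(2 * σ * u))) u =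
      ∫ u in Set.Ici a, c * Real.exp (-(2 * σ * u)) := by
    rw [setIntegral_indicator measurableSet_Ici, Set.Ici_inter_Ici, sup_eq_right.2 ha]
  rw [← integral_Ici_eq_integral_Ioi, hset, integral_Ici_eq_integral_Ioi, integral_const_mul]
  have := integral_exp_mul_Ioi (a := -(2 * σ)) (by linarith) a
  simp only [neg_mul] at this
  rw [this]
  field_simp

theorem T_exp_mul_exp (h : ℕ) (σ u : ℝ) :
    T (Real.exp u) h * Real.exp (-(2 * σ * u)) =
      6 / Real.pi ^ 2 * ∑' x : ℕ × ℕ, (Set.Ici (Real.log (max x.1 x.2 : ℕ))).indicator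
        (fun u => pairCoeff h x * Real.exp (-(2 * σ * u))) u := by
  have hmem : ∀ n : ℕ, n ≠ 0 → (n ≤ ⌊Real.exp u⌋₊ ↔ Real.log n ≤ u) := fun n hn => by
    rw [Nat.le_floor_iff (Real.exp_pos u).le,
      Real.log_le_iff_le_exp (by exact_mod_cast Nat.pos_of_ne_zero hn)]
  rw [T, ← sum_product', mul_assoc, sum_mul, tsum_eq_sum
    (s := Finset.Icc 1 ⌊Real.exp u⌋₊ ×ˢ Finset.Icc 1 ⌊Real.exp u⌋₊)]
  · congr 1
    refine sum_congr rfl fun x hx => ?_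
    simp only [mem_product, Finset.mem_Icc] at hx
    rw [Set.indicator_of_mem]
    · rfl
    · exact (hmem _ (by omega)).1 (by omega)
  · intro x hx
    by_cases hsq : Squarefree x.1 ∧ Squarefree x.2
    · refine Set.indicator_of_notMem (fun hu => hx ?_) _
      have h1 := Nat.pos_of_ne_zero hsq.1.ne_zero
      have h2 := Nat.pos_of_ne_zero hsq.2.ne_zero
      have := (hmem (max x.1 x.2) (by omega)).2 hu
      simp only [mem_product, Finset.mem_Icc]
      omega
    · simp [pairCoeff_eq_zero hsq]

theorem abs_pairCoeff_mul_exp_le (h : ℕ) (x : ℕ × ℕ) {σ : ℝ} (hσ : 0 < σ) :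
    |pairCoeff h x| * Real.exp (-(2 * σ * Real.log (max x.1 x.2 : ℕ))) ≤
      |pairCoeff h x| * ((x.1 : ℝ) ^ (-σ) * (x.2 : ℝ) ^ (-σ)) := by
  by_cases hsq : Squarefree x.1 ∧ Squarefree x.2
  swap
  · simp [pairCoeff_eq_zero hsq]
  have h1 : (0 : ℝ) < x.1 := by exact_mod_cast Nat.pos_of_ne_zero hsq.1.ne_zero
  have h2 : (0 : ℝ) < x.2 := by exact_mod_cast Nat.pos_of_ne_zero hsq.2.ne_zero
  refine mul_le_mul_of_nonneg_left ?_ (abs_nonneg _)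
  rw [← exp_log_add_log_mul_exp_abs_sub hsq.1.ne_zero hsq.2.ne_zero, Real.rpow_def_of_pos h1,
    Real.rpow_def_of_pos h2, ← Real.exp_add, ← Real.exp_add]
  refine Real.exp_le_exp.2 ?_
  nlinarith [mul_nonneg hσ.le (abs_nonneg (Real.log x.2 - Real.log x.1))]

theorem hasSum_integral_T {h : ℕ} (hh : h ≠ 0) {σ : ℝ} (hσ : 1 / 2 < σ) :
    HasSum (fun x : ℕ × ℕ => (2 * σ)⁻¹ * (pairCoeff h x *
        Real.exp (-(2 * σ * Real.log (max x.1 x.2 : ℕ)))))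
      (Real.pi ^ 2 / 6 * ∫ u in Set.Ioi (0 : ℝ),
        T (Real.exp u) h * Real.exp (-(2 * σ * u))) := by
  have hσ0 : 0 < σ := by linarith
  have key := hasSum_integral_of_summable_integral_norm (μ := volume.restrict (Set.Ioi (0 : ℝ)))
    (F := fun (x : ℕ × ℕ) u => (Set.Ici (Real.log (max x.1 x.2 : ℕ))).indicator
        (fun u => pairCoeff h x * Real.exp (-(2 * σ * u))) u)
    (fun x => integrableOn_indicator_exp hσ0 _ _) ?_
  · simp only [integral_indicator_exp hσ0 (Real.log_natCast_nonneg _)] at key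
    convert! key using 1
    simp only [T_exp_mul_exp, integral_const_mul]
    rw [← mul_assoc]
    have := Real.pi_ne_zero
    field_simp
  · have hnorm : ∀ (x : ℕ × ℕ) (u : ℝ), ‖(Set.Ici (Real.log (max x.1 x.2 : ℕ))).indicator
        (fun u => pairCoeff h x * Real.exp (-(2 * σ * u))) u‖ =
        (Set.Ici (Real.log (max x.1 x.2 : ℕ))).indicator
          (fun u => |pairCoeff h x| * Real.exp (-(2 * σ * u))) u := by
      intro x u
      simp only [norm_indicator_eq_indicator_norm, norm_mul, Real.norm_eq_abs, Real.abs_exp]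
    simp only [hnorm, integral_indicator_exp hσ0 (Real.log_natCast_nonneg _)]
    refine Summable.mul_left _ ?_
    exact Summable.of_nonneg_of_le (fun x => by positivity)
      (fun x => abs_pairCoeff_mul_exp_le h x hσ0) (summable_abs_pairCoeff_mul_rpow hh hσ)

theorem stmt17 :
    ∀ h : ℕ, 1 ≤ h → Squarefree h → ∀ σ : ℝ, 1 / 2 < σ →
      ∫ u in Set.Ioi (0 : ℝ), T (Real.exp u) h * Real.exp (-(2 * σ * u)) =
        ((Nat.totient h : ℝ) / (2 * Real.pi * (h : ℝ) ^ 2)) *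
          ∫ τ : ℝ,
            (fC h ((σ : ℂ) + (τ : ℂ) * Complex.I) *
              ∏' p : {p : Nat.Primes // ¬ ((p : ℕ) ∣ h)},
                (1 - 1 / ((p.1 : ℕ) : ℝ)) *
                  (1 + fC (p.1 : ℕ) ((σ : ℂ) + (τ : ℂ) * Complex.I) / ((p.1 : ℕ) : ℝ))) /
              (σ ^ 2 + τ ^ 2) := by
  intro h _ hsq σ hσ
  obtain ⟨H, rfl⟩ := Nat.Primes.mem_range_prodSet hsq
  have hσ0 : 0 < σ := by linarith
  have h1 := hasSum_integral_vertical H hσ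
  have h2 := (hasSum_integral_T (Nat.Primes.prodSet_ne_zero H) hσ).mul_left (2 * Real.pi)
  have heq := h1.unique (h2.congr_fun fun x => ?_)
  · have := Real.pi_ne_zero
    generalize (∫ u in Set.Ioi (0 : ℝ), T (Real.exp u) (Nat.Primes.prodSet H) *
      Real.exp (-(2 * σ * u))) = A at heq ⊢
    generalize (∫ τ : ℝ, (_ : ℝ)) = B at heq ⊢
    have hne : (Nat.Primes.prodSet H : ℝ) ≠ 0 := by exact_mod_cast Nat.Primes.prodSet_ne_zero H
    field_simp at heq ⊢
    linarith
  · field_simp
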